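/- Let A be the Artin group of type D_4. Let x_0 be a left coset of A_b̂, let x_1, x_3 be distinct left cosets of A_â, and let x_2, x_4 be distinct left cosets of A_ĉ, with x_0 ∩ x_1, x_1 ∩ x_2, x_2 ∩ x_3, x_3 ∩ x_4 and x_4 ∩ x_0 all nonempty (an embedded 5-cycle). Then at least one of the following holds: (1) there exist a left coset y_1 of A_â and a left coset y_2 of A_ĉ, each having nonempty intersection with x_0, such that x_4 ∩ y_1, y_1 ∩ y_2 and y_2 ∩ x_1 are all nonempty; (2) x_4 ∩ x_1 ≠ ∅. -/

import Mathlib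

/-!
The Artin group of type `D₄`, with generators `a, b, c, d`, where `d` is the central node of
the Dynkin diagram: relations `ada = dad`, `bdb = dbd`, `cdc = dcd`, `ab = ba`, `ac = ca`,
`bc = cb`.
-/

open Pointwise

namespace D4Artin

/-- The generators of the `D₄` Artin group. -/
inductive Gen : Type
  | a | b | c | d
deriving DecidableEq

open Gen

/-- The defining relators of the `D₄` Artin group: a braid relation `sts = tst` whenever one of
`s, t` is the central node `d`, and commutation `st = ts` otherwise. -/
def Rels : Set (FreeGroup Gen) :=
  { r | ∃ s t : Gen, s ≠ t ∧
      (((s = d ∨ t = d) ∧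
          r = FreeGroup.of s * FreeGroup.of t * FreeGroup.of s *
              (FreeGroup.of t * FreeGroup.of s * FreeGroup.of t)⁻¹) ∨
        ((s ≠ d ∧ t ≠ d) ∧
          r = FreeGroup.of s * FreeGroup.of t * (FreeGroup.of s)⁻¹ * (FreeGroup.of t)⁻¹)) }

/-- The Artin group of type `D₄`. -/
abbrev Artin : Type := PresentedGroup Rels

/-- The generators, as elements of the Artin group. -/
def gen (s : Gen) : Artin := PresentedGroup.of s

/-- The standard parabolic subgroup `A_ŝ` generated by the three generators other than `s`. -/
def Ahat (s : Gen) : Subgroup Artin :=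
  Subgroup.closure { x | ∃ t : Gen, t ≠ s ∧ x = gen t }

/-- `X` is a left coset of the subgroup `H`. -/
def IsCosetOf (X : Set Artin) (H : Subgroup Artin) : Prop :=
  ∃ g : Artin, X = g • (H : Set Artin)

end D4Artin

namespace D4Artin

open Gen

/-- The action of the generators on the eight cosets of the Weyl group `W(D₄)` modulo its
parabolic subgroup generated by `a, c, d`, numbered so that `0` is the trivial coset. -/
def move : Gen → Fin 8 → Fin 8
  | a => ![0, 1, 3, 2, 5, 4, 6, 7]
  | b => ![1, 0, 2, 3, 4, 5, 7, 6]
  | c => ![0, 1, 4, 5, 2, 3, 6, 7]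
  | d => ![0, 2, 1, 3, 4, 6, 5, 7]

/-- The cocycle, on generators, of the retraction of the Artin group onto `A_b̂`: where a generator
fixes a coset, it is the conjugate of that generator by the minimal representative. -/
def emit : Gen → Fin 8 → Artin
  | a => ![gen a, gen a, 1, 1, 1, 1, gen c, gen c]
  | b => ![1, 1, gen d, gen d, gen d, gen d, 1, 1]
  | c => ![gen c, gen c, 1, 1, 1, 1, gen a, gen a]
  | d => ![gen d, 1, 1, gen a, gen c, 1, 1, gen d]

lemma move_move (s : Gen) (v : Fin 8) : move s (move s v) = v := by
  revert v
  cases s <;> decide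

lemma emit_move (s : Gen) (v : Fin 8) : emit s (move s v) = emit s v := by
  cases s <;> fin_cases v <;> rfl

/-- The permutation of `Fin 8 × Artin` by which a generator acts. -/
def stepPerm (s : Gen) : Equiv.Perm (Fin 8 × Artin) where
  toFun x := (move s x.1, emit s x.1 * x.2)
  invFun x := (move s x.1, (emit s x.1)⁻¹ * x.2)
  left_inv x := by simp [move_move, emit_move]
  right_inv x := by simp [move_move, emit_move]

lemma stepPerm_apply (s : Gen) (x : Fin 8 × Artin) :
    stepPerm s x = (move s x.1, emit s x.1 * x.2) := rfl

lemma gen_braid {s t : Gen} (hst : s ≠ t) (h : s = d ∨ t = d) :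
    gen s * gen t * gen s = gen t * gen s * gen t := by
  have := PresentedGroup.one_of_mem (rels := Rels) ⟨s, t, hst, Or.inl ⟨h, rfl⟩⟩
  rw [map_mul, map_inv, mul_inv_eq_one] at this
  simp only [map_mul] at this
  exact this

lemma gen_comm {s t : Gen} (hst : s ≠ t) (hs : s ≠ d) (ht : t ≠ d) :
    gen s * gen t = gen t * gen s := by
  have := PresentedGroup.one_of_mem (rels := Rels) ⟨s, t, hst, Or.inr ⟨⟨hs, ht⟩, rfl⟩⟩
  rw [map_mul, map_mul, map_inv, map_inv, mul_inv_eq_one, mul_inv_eq_iff_eq_mul] at this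
  simp only [map_mul] at this
  exact this

lemma stepPerm_comm {s t : Gen} (hst : s ≠ t) (hs : s ≠ d) (ht : t ≠ d) :
    stepPerm s * stepPerm t = stepPerm t * stepPerm s := by
  have hac := gen_comm (s := a) (t := c) (by decide) (by decide) (by decide)
  ext ⟨v, x⟩ : 1
  cases s <;> cases t <;> first | contradiction | skip
  all_goals
    fin_cases v <;> simp [Equiv.Perm.mul_apply, stepPerm_apply, move, emit, ← mul_assoc, hac]

lemma stepPerm_braid_d {s : Gen} (hs : s ≠ d) :
    stepPerm s * stepPerm d * stepPerm s = stepPerm d * stepPerm s * stepPerm d := by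
  have had := gen_braid (s := a) (t := d) (by decide) (by decide)
  have hcd := gen_braid (s := c) (t := d) (by decide) (by decide)
  ext ⟨v, x⟩ : 1
  cases s <;> first | contradiction | skip
  all_goals
    fin_cases v <;> simp [Equiv.Perm.mul_apply, stepPerm_apply, move, emit, ← mul_assoc, had, hcd]

lemma stepPerm_braid {s t : Gen} (hst : s ≠ t) (h : s = d ∨ t = d) :
    stepPerm s * stepPerm t * stepPerm s = stepPerm t * stepPerm s * stepPerm t := by
  rcases h with rfl | rfl
  · exact (stepPerm_braid_d hst.symm).symm
  · exact stepPerm_braid_d hst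

/-- The action of the Artin group on `Fin 8 × Artin`, combining the action on cosets with the
cocycle of the retraction onto `A_b̂`. -/
def cosetAction : Artin →* Equiv.Perm (Fin 8 × Artin) :=
  PresentedGroup.toGroup (f := stepPerm) <| by
    rintro r ⟨s, t, hst, ⟨h, rfl⟩ | ⟨⟨hs, ht⟩, rfl⟩⟩
    · simp only [map_mul, map_inv, FreeGroup.lift_apply_of]
      rw [mul_inv_eq_one]
      exact stepPerm_braid hst h
    · simp only [map_mul, map_inv, FreeGroup.lift_apply_of]
      rw [mul_inv_eq_one, mul_inv_eq_iff_eq_mul]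
      exact stepPerm_comm hst hs ht

lemma cosetAction_gen (s : Gen) (x : Fin 8 × Artin) :
    cosetAction (gen s) x = (move s x.1, emit s x.1 * x.2) := by
  rw [cosetAction, gen, PresentedGroup.toGroup.of, stepPerm_apply]

lemma cosetAction_gen_inv (s : Gen) (x : Fin 8 × Artin) :
    cosetAction (gen s)⁻¹ x = (move s x.1, (emit s x.1)⁻¹ * x.2) := by
  rw [map_inv, Equiv.Perm.inv_eq_iff_eq, cosetAction_gen]
  simp [move_move, emit_move]

/-- The action restricted to `A_b̂` fixes the trivial coset, and is left multiplication there. -/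
lemma cosetAction_of_mem_Ahat_b {g : Artin} (hg : g ∈ Ahat b) (x : Artin) :
    cosetAction g (0, x) = (0, g * x) := by
  induction hg using Subgroup.closure_induction generalizing x with
  | mem y hy =>
    obtain ⟨t, ht, rfl⟩ := hy
    rw [cosetAction_gen]
    cases t <;> first | contradiction | rfl
  | one => simp
  | mul y z _ _ hy hz => rw [map_mul, Equiv.Perm.mul_apply, hz, hy, mul_assoc]
  | inv y _ hy => rw [map_inv, Equiv.Perm.inv_eq_iff_eq, hy, mul_inv_cancel_left]

/-- If the generators of `A_ŝ` preserve a labelling of the cosets and their cocycle takes values in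
subgroups depending on the label only, the same holds for all of `A_ŝ`. -/
lemma cosetAction_of_mem_Ahat {β : Type*} {s : Gen} (f : Fin 8 → β) (K : β → Subgroup Artin)
    (hf : ∀ t ≠ s, ∀ v, f (move t v) = f v) (hK : ∀ t ≠ s, ∀ v, emit t v ∈ K (f v))
    {g : Artin} (hg : g ∈ Ahat s) (v : Fin 8) (x : Artin) :
    ∃ w, ∃ k ∈ K (f v), f w = f v ∧ cosetAction g (v, x) = (w, k * x) := by
  induction hg using Subgroup.closure_induction'' generalizing v x with
  | mem y hy =>
    obtain ⟨t, ht, rfl⟩ := hy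
    exact ⟨_, _, hK t ht v, hf t ht v, cosetAction_gen t _⟩
  | inv_mem y hy =>
    obtain ⟨t, ht, rfl⟩ := hy
    exact ⟨_, _, inv_mem (hK t ht v), hf t ht v, cosetAction_gen_inv t _⟩
  | one => exact ⟨v, 1, one_mem _, rfl, by simp⟩
  | mul y z _ _ hy hz =>
    obtain ⟨w, k, hk, hw, h⟩ := hz v x
    obtain ⟨w', k', hk', hw', h'⟩ := hy w (k * x)
    rw [hw] at hk' hw'
    exact ⟨w', k' * k, mul_mem hk' hk, hw', by
      rw [map_mul, Equiv.Perm.mul_apply, h, h', mul_assoc]⟩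

lemma gen_mem_Ahat {s t : Gen} (h : t ≠ s) : gen t ∈ Ahat s :=
  Subgroup.subset_closure ⟨t, h, rfl⟩

lemma cosetAction_of_mem_Ahat_a {g : Artin} (hg : g ∈ Ahat a) (v : Fin 8) (x : Artin) :
    ∃ w k, (k ∈ Ahat a ⊓ Ahat b ∨ k ∈ Ahat b ⊓ Ahat c) ∧ (w = 0 → k ∈ Ahat a ⊓ Ahat b) ∧
      cosetAction g (v, x) = (w, k * x) := by
  obtain ⟨w, k, hk, hw, h⟩ := cosetAction_of_mem_Ahat (s := a)
    ![true, true, true, false, true, false, false, false]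
    (fun i => if i then Ahat a ⊓ Ahat b else Ahat b ⊓ Ahat c)
    (by intro t ht; cases t <;> first | contradiction | decide)
    (by
      intro t ht v
      cases t <;> first | contradiction | skip
      all_goals fin_cases v <;> simp [emit, one_mem, gen_mem_Ahat])
    hg v x
  refine ⟨w, k, ?_, ?_, h⟩
  · split_ifs at hk
    exacts [Or.inl hk, Or.inr hk]
  · rintro rfl
    simpa [← hw] using hk

lemma cosetAction_of_mem_Ahat_c {g : Artin} (hg : g ∈ Ahat c) (v : Fin 8) (x : Artin) :
    ∃ w k, (k ∈ Ahat a ⊓ Ahat b ∨ k ∈ Ahat b ⊓ Ahat c) ∧ (v = 0 → k ∈ Ahat b ⊓ Ahat c) ∧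
      cosetAction g (v, x) = (w, k * x) := by
  obtain ⟨w, k, hk, -, h⟩ := cosetAction_of_mem_Ahat (s := c)
    ![true, true, true, true, false, false, false, false]
    (fun i => if i then Ahat b ⊓ Ahat c else Ahat a ⊓ Ahat b)
    (by intro t ht; cases t <;> first | contradiction | decide)
    (by
      intro t ht v
      cases t <;> first | contradiction | skip
      all_goals fin_cases v <;> simp [emit, one_mem, gen_mem_Ahat])
    hg v x
  refine ⟨w, k, ?_, ?_, h⟩
  · split_ifs at hk
    exacts [Or.inr hk, Or.inl hk]
  · rintro rfl
    simpa using hk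

/-- An element of `A_b̂` that lies in `A_â A_ĉ A_â A_ĉ` has a factorization of the same shape with
all factors in `A_b̂`. -/
theorem exists_factorization_in_Ahat_b {p q r s : Artin} (hp : p ∈ Ahat a) (hq : q ∈ Ahat c)
    (hr : r ∈ Ahat a) (hs : s ∈ Ahat c) (h : p * q * r * s ∈ Ahat b) :
    ∃ p' ∈ Ahat a ⊓ Ahat b, ∃ q' ∈ Ahat b ⊓ Ahat c, ∃ r' ∈ Ahat a ⊓ Ahat b,
      ∃ s' ∈ Ahat b ⊓ Ahat c, p * q * r * s = p' * q' * r' * s' := by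
  have key := cosetAction_of_mem_Ahat_b h 1
  obtain ⟨v, s', -, hs', es⟩ := cosetAction_of_mem_Ahat_c hs 0 1
  obtain ⟨w, r', hr', -, er⟩ := cosetAction_of_mem_Ahat_a hr v (s' * 1)
  obtain ⟨u, q', hq', -, eq⟩ := cosetAction_of_mem_Ahat_c hq w (r' * (s' * 1))
  obtain ⟨o, p', -, hp', ep⟩ := cosetAction_of_mem_Ahat_a hp u (q' * (r' * (s' * 1)))
  simp only [map_mul, Equiv.Perm.mul_apply] at key
  rw [es, er, eq, ep, Prod.mk.injEq, mul_one, mul_one] at key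
  obtain ⟨ho, key⟩ := key
  replace hs' := hs' rfl
  replace hp' := hp' ho
  rw [← key]
  rcases hq' with hq' | hq' <;> rcases hr' with hr' | hr'
  · exact ⟨_, mul_mem (mul_mem hp' hq') hr', 1, one_mem _, 1, one_mem _, s', hs', by group⟩
  · exact ⟨_, mul_mem hp' hq', 1, one_mem _, 1, one_mem _, _, mul_mem hr' hs', by group⟩
  · exact ⟨p', hp', q', hq', r', hr', s', hs', by group⟩
  · exact ⟨p', hp', 1, one_mem _, 1, one_mem _, _, mul_mem (mul_mem hq' hr') hs', by group⟩

lemma IsCosetOf.eq_smul {X : Set Artin} {H : Subgroup Artin} (hX : IsCosetOf X H) {x : Artin}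
    (hx : x ∈ X) : X = x • (H : Set Artin) := by
  obtain ⟨g, rfl⟩ := hX
  exact (leftCoset_eq_iff H).2 ((mem_leftCoset_iff g).1 hx)

lemma IsCosetOf.inv_mul_mem {X : Set Artin} {H : Subgroup Artin} (hX : IsCosetOf X H)
    {x y : Artin} (hx : x ∈ X) (hy : y ∈ X) : x⁻¹ * y ∈ H := by
  rw [hX.eq_smul hx] at hy
  exact (mem_leftCoset_iff x).1 hy

lemma IsCosetOf.mul_mem {X : Set Artin} {H : Subgroup Artin} (hX : IsCosetOf X H) {x h : Artin}
    (hx : x ∈ X) (hh : h ∈ H) : x * h ∈ X := by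
  rw [hX.eq_smul hx]
  exact mem_leftCoset x hh

end D4Artin

open D4Artin D4Artin.Gen

/-- For every embedded 5-cycle `x 0, x 1, x 2, x 3, x 4` in the `D₄` Artin complex with
`x 0` of type `b̂`, `x 1, x 3` of type `â` and `x 2, x 4` of type `ĉ`, either (1) there is an
edge path `x 4, y 1, y 2, x 1` in the link of `x 0`, with `y 1` a left coset of `A_â` and
`y 2` a left coset of `A_ĉ` each meeting `x 0`; or (2) `x 4` and `x 1` are adjacent. -/
theorem five_cycle_local_structure
    (x0 x1 x2 x3 x4 : Set Artin)
    (h0 : IsCosetOf x0 (Ahat b))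
    (h1 : IsCosetOf x1 (Ahat a)) (h3 : IsCosetOf x3 (Ahat a))
    (h2 : IsCosetOf x2 (Ahat c)) (h4 : IsCosetOf x4 (Ahat c))
    (h13 : x1 ≠ x3) (h24 : x2 ≠ x4)
    (e01 : (x0 ∩ x1).Nonempty) (e12 : (x1 ∩ x2).Nonempty) (e23 : (x2 ∩ x3).Nonempty)
    (e34 : (x3 ∩ x4).Nonempty) (e40 : (x4 ∩ x0).Nonempty) :
    (∃ y1 y2 : Set Artin, IsCosetOf y1 (Ahat a) ∧ IsCosetOf y2 (Ahat c) ∧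
      (y1 ∩ x0).Nonempty ∧ (y2 ∩ x0).Nonempty ∧
      (x4 ∩ y1).Nonempty ∧ (y1 ∩ y2).Nonempty ∧ (y2 ∩ x1).Nonempty) ∨
    (x4 ∩ x1).Nonempty := by
 
  obtain ⟨z, hz0, hz1⟩ := e01
  obtain ⟨z12, h12, h12'⟩ := e12
  obtain ⟨z23, h23, h23'⟩ := e23
  obtain ⟨z34, h34, h34'⟩ := e34
  obtain ⟨z40, h40, h40'⟩ := e40
  have hprod : z⁻¹ * z12 * (z12⁻¹ * z23) * (z23⁻¹ * z34) * (z34⁻¹ * z40) = z⁻¹ * z40 := by group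
  obtain ⟨p, hp, q, hq, r, hr, s, hs, hfac⟩ := exists_factorization_in_Ahat_b
    (h1.inv_mul_mem hz1 h12) (h2.inv_mul_mem h12' h23) (h3.inv_mul_mem h23' h34)
    (h4.inv_mul_mem h34' h40) (hprod ▸ h0.inv_mul_mem hz0 h40')
  have hz40 : z * p * q * r = z40 * s⁻¹ := by
    rw [hprod, inv_mul_eq_iff_eq_mul] at hfac
    rw [hfac]
    group
  have hy1 : IsCosetOf ((z * p * q) • (Ahat a : Set Artin)) (Ahat a) := ⟨_, rfl⟩
  have hy2 : IsCosetOf ((z * p) • (Ahat c : Set Artin)) (Ahat c) := ⟨_, rfl⟩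
  have m1 := mem_own_leftCoset (Ahat a).toSubmonoid (z * p * q)
  have m2 := mem_own_leftCoset (Ahat c).toSubmonoid (z * p)
  have hzp : z * p ∈ x0 := h0.mul_mem hz0 hp.2
  exact Or.inl ⟨_, _, hy1, hy2, ⟨_, m1, h0.mul_mem hzp hq.1⟩, ⟨_, m2, hzp⟩,
    ⟨_, hz40 ▸ h4.mul_mem h40 (inv_mem hs.2), hy1.mul_mem m1 hr.1⟩,
    ⟨_, m1, hy2.mul_mem m2 hq.2⟩, ⟨_, m2, h1.mul_mem hz1 hp.1⟩⟩
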